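/- There exists a constant B ∈ (0,∞) such that for all q¹, q² ∈ ℝ₊^J one has |λ|·(d̃(q²) − d̃(q¹)) ≤ h·(q² − q¹) + B·‖K M q² − K M q¹‖₂, where ‖·‖₂ is the Euclidean norm on ℝ^I. -/

import Mathlib

open Matrix

/-- `(KM)q` where `M` is the diagonal matrix with entries `1/βⱼ`. -/
noncomputable def kmVec {I J : ℕ} (K : Matrix (Fin I) (Fin J) ℝ) (β : Fin J → ℝ)
    (q : Fin J → ℝ) : Fin I → ℝ :=
  K.mulVec fun j => q j / β j

/-- `d̃(q) = sup { v·u* : v ∈ ker K, q + βv ≥ 0 }`. -/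
noncomputable def dtilde {I J : ℕ} (K : Matrix (Fin I) (Fin J) ℝ) (β ustar : Fin J → ℝ)
    (q : Fin J → ℝ) : ℝ :=
  sSup {x : ℝ | ∃ v : Fin J → ℝ, K.mulVec v = 0 ∧ (∀ j, 0 ≤ q j + β j * v j) ∧ x = v ⬝ᵥ ustar}

/-- Euclidean norm on `ℝ^n`. -/
noncomputable def euclNorm {n : ℕ} (x : Fin n → ℝ) : ℝ :=
  Real.sqrt (∑ i, x i ^ 2)

theorem mulVec_nonneg_of_nonneg {m n : ℕ} {A : Matrix (Fin m) (Fin n) ℝ} {x : Fin n → ℝ}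
    (hA : ∀ i j, 0 ≤ A i j) (hx : ∀ j, 0 ≤ x j) (i : Fin m) : 0 ≤ (A *ᵥ x) i := by
  rw [Matrix.mulVec, dotProduct]
  exact Finset.sum_nonneg fun j _ => mul_nonneg (hA i j) (hx j)

/-- Lipschitz stability of nonnegative solutions of `K w = b` at bounded linear cost, for a `0`-`1`
matrix `K` whose columns contain all the unit vectors. -/
theorem exists_nonneg_mulVec_eq_of_abs_sub_le {I J : ℕ} (K : Matrix (Fin I) (Fin J) ℝ)
    (hK01 : ∀ i j, K i j = 0 ∨ K i j = 1)
    (hloc : ∀ i, ∃ j, K i j = 1 ∧ ∀ l, l ≠ i → K l j = 0)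
    (c : Fin J → ℝ) (hc : ∀ j, 0 ≤ c j) :
    ∃ B : ℝ, 0 < B ∧ ∀ (w : Fin J → ℝ) (a : Fin I → ℝ) (t : ℝ), (∀ j, 0 ≤ w j) →
      (∀ i, 0 ≤ a i) → 0 ≤ t → (∀ i, |a i - (K *ᵥ w) i| ≤ t) →
      ∃ w' : Fin J → ℝ, (∀ j, 0 ≤ w' j) ∧ K *ᵥ w' = a ∧ c ⬝ᵥ w' ≤ c ⬝ᵥ w + B * t := by
  choose σ hσ1 hσ0 using hloc
  have hK0 : ∀ i j, 0 ≤ K i j := fun i j => by rcases hK01 i j with h | h <;> simp [h]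
  have hK1 : ∀ i j, K i j ≤ 1 := fun i j => by rcases hK01 i j with h | h <;> simp [h]
  have hS : 0 ≤ ∑ i, c (σ i) := Finset.sum_nonneg fun i _ => hc _
  refine ⟨(∑ i, c (σ i)) * (J + 1) + 1, by positivity, fun w a t hw ha ht hat => ?_⟩
  set z : Fin J → ℝ := fun j => max (w j - t) 0 with hz
  have hz0 : ∀ j, 0 ≤ z j := fun j => le_max_right _ _
  have hzw : ∀ j, z j ≤ w j := fun j => max_le (by linarith) (hw j)
  have hwz : ∀ j, w j - z j ≤ t := fun j => by linarith [le_max_left (w j - t) 0]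
  set r : Fin I → ℝ := a - K *ᵥ z with hr
  have hKwz : ∀ i, (K *ᵥ w) i - (K *ᵥ z) i = ∑ j, K i j * (w j - z j) := fun i => by
    simp [Matrix.mulVec, dotProduct, mul_sub]
  have hterm : ∀ i j, 0 ≤ K i j * (w j - z j) := fun i j =>
    mul_nonneg (hK0 i j) (by linarith [hzw j])
  have hr0 : ∀ i, 0 ≤ r i := by
    intro i
    rw [hr, Pi.sub_apply]
    by_cases hex : ∃ j, K i j = 1 ∧ t ≤ w j
    · obtain ⟨j, hj, hjt⟩ := hex
      have h1 := Finset.single_le_sum (fun k _ => hterm i k) (Finset.mem_univ j)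
      have h2 : z j = w j - t := max_eq_left (by linarith)
      rw [← hKwz, h2, hj] at h1
      linarith [(abs_le.mp (hat i)).1]
    · push Not at hex
      have h0 : (K *ᵥ z) i = 0 := by
        rw [Matrix.mulVec, dotProduct]
        refine Finset.sum_eq_zero fun j _ => ?_
        rcases hK01 i j with h | h
        · simp [h]
        · have : z j = 0 := max_eq_right (by linarith [hex j h])
          simp [this]
      linarith [ha i]
  have hrt : ∀ i, r i ≤ (J + 1) * t := by
    intro i
    have h1 : ∑ j, K i j * (w j - z j) ≤ ∑ _j : Fin J, t := Finset.sum_le_sum fun j _ =>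
      (mul_le_of_le_one_left (by linarith [hzw j]) (hK1 i j)).trans (hwz j)
    rw [← hKwz] at h1
    simp only [Finset.sum_const, Finset.card_univ, Fintype.card_fin, nsmul_eq_mul] at h1
    rw [hr, Pi.sub_apply]
    linarith [(abs_le.mp (hat i)).2]
  let P : Matrix (Fin J) (Fin I) ℝ := Matrix.of fun j i => if j = σ i then 1 else 0
  have hP0 : ∀ j i, 0 ≤ P j i := fun j i => by
    simp only [P, Matrix.of_apply]; split_ifs <;> norm_num
  have hKP : K * P = 1 := by
    ext l i
    simp only [P, Matrix.mul_apply, Matrix.of_apply, mul_ite, mul_one, mul_zero,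
      Finset.sum_ite_eq', Finset.mem_univ, if_true, Matrix.one_apply]
    split_ifs with hli
    · rw [hli, hσ1]
    · exact hσ0 i l hli
  refine ⟨z + P *ᵥ r, fun j => add_nonneg (hz0 j) (mulVec_nonneg_of_nonneg hP0 hr0 j), ?_, ?_⟩
  · rw [Matrix.mulVec_add, Matrix.mulVec_mulVec, hKP, Matrix.one_mulVec, hr]
    abel
  · have h1 : c ⬝ᵥ z ≤ c ⬝ᵥ w := Finset.sum_le_sum fun j _ =>
      mul_le_mul_of_nonneg_left (hzw j) (hc j)
    have h2 : c ⬝ᵥ (P *ᵥ r) = ∑ i, c (σ i) * r i := by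
      rw [Matrix.dotProduct_mulVec]
      simp [dotProduct, Matrix.vecMul, P]
    have h3 : ∑ i, c (σ i) * r i ≤ ∑ i, c (σ i) * ((J + 1) * t) :=
      Finset.sum_le_sum fun i _ => mul_le_mul_of_nonneg_left (hrt i) (hc _)
    rw [← Finset.sum_mul] at h3
    rw [dotProduct_add, h2]
    linarith

theorem abs_le_euclNorm {n : ℕ} (x : Fin n → ℝ) (i : Fin n) : |x i| ≤ euclNorm x :=
  Real.abs_le_sqrt (Finset.single_le_sum (f := fun i => x i ^ 2) (fun _ _ => sq_nonneg _)
    (Finset.mem_univ i))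

/-- There is `B ∈ (0,∞)` with
`|λ|(d̃(q²) − d̃(q¹)) ≤ h·(q² − q¹) + B‖KMq² − KMq¹‖₂` for all `q¹, q² ∈ ℝ₊^J`. -/
theorem stmt12 (I J : ℕ) (hI : 0 < I) (hJ : 0 < J)
    (K : Matrix (Fin I) (Fin J) ℝ)
    (hK01 : ∀ i j, K i j = 0 ∨ K i j = 1)
    (hcol : ∀ j, ∃ i, K i j = 1)
    (hloc : ∀ i, ∃ j, K i j = 1 ∧ ∀ l, l ≠ i → K l j = 0)
    (β : Fin J → ℝ) (hβ : ∀ j, 0 < β j)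
    (h : Fin J → ℝ) (hh : ∀ j, 0 < h j)
    (hC : {u : Fin J → ℝ | K.mulVec u = 0 ∧ (fun j => h j * β j) ⬝ᵥ u = 0} ≠
          {u : Fin J → ℝ | K.mulVec u = 0})
    (ustar : Fin J → ℝ)
    (hker : K.mulVec ustar = 0)
    (hunit : ∑ j, ustar j ^ 2 = 1)
    (horth : ∀ u : Fin J → ℝ, K.mulVec u = 0 → (fun j => h j * β j) ⬝ᵥ u = 0 →
      u ⬝ᵥ ustar = 0)
    (hneg : (fun j => h j * β j) ⬝ᵥ ustar < 0) :
    ∃ B : ℝ, 0 < B ∧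
      ∀ q₁ q₂ : Fin J → ℝ, (∀ j, 0 ≤ q₁ j) → (∀ j, 0 ≤ q₂ j) →
        |(fun j => h j * β j) ⬝ᵥ ustar| * (dtilde K β ustar q₂ - dtilde K β ustar q₁) ≤
          h ⬝ᵥ (fun j => q₂ j - q₁ j) +
            B * euclNorm (fun i => kmVec K β q₂ i - kmVec K β q₁ i) := by
  set c : Fin J → ℝ := fun j => h j * β j with hc
  have hc0 : ∀ j, 0 ≤ c j := fun j => (mul_pos (hh j) (hβ j)).le
  have hK0 : ∀ i j, 0 ≤ K i j := fun i j => by rcases hK01 i j with h | h <;> simp [h]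
  have huu : ustar ⬝ᵥ ustar = 1 := by
    rw [← hunit]; exact Finset.sum_congr rfl fun j _ => (sq _).symm
  have hcost : ∀ v, K *ᵥ v = 0 → |c ⬝ᵥ ustar| * (v ⬝ᵥ ustar) = -(c ⬝ᵥ v) := by
    intro v hv
    have h1 := horth (v - (c ⬝ᵥ v / c ⬝ᵥ ustar) • ustar)
      (by rw [Matrix.mulVec_sub, Matrix.mulVec_smul, hv, hker]; simp)
      (by
        rw [dotProduct_sub, dotProduct_smul, smul_eq_mul, div_mul_cancel₀ _ hneg.ne, sub_self])
    rw [sub_dotProduct, smul_dotProduct, huu, smul_eq_mul, mul_one, sub_eq_zero] at h1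
    rw [h1, abs_of_neg hneg, neg_mul, mul_div_cancel₀ _ hneg.ne]
  have hlam : 0 < |c ⬝ᵥ ustar| := abs_pos.mpr hneg.ne
  have hscale : ∀ q : Fin J → ℝ, c ⬝ᵥ (fun j => q j / β j) = h ⬝ᵥ q := fun q =>
    Finset.sum_congr rfl fun j _ => by
      have := (hβ j).ne'
      simp only [hc]; field_simp
  obtain ⟨B, hB, hrep⟩ := exists_nonneg_mulVec_eq_of_abs_sub_le K hK01 hloc c hc0
  refine ⟨B, hB, fun q₁ q₂ hq₁ hq₂ => ?_⟩
  set t := euclNorm (fun i => kmVec K β q₂ i - kmVec K β q₁ i) with ht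
  have hbdd : BddAbove {x : ℝ | ∃ v : Fin J → ℝ, K.mulVec v = 0 ∧
      (∀ j, 0 ≤ q₁ j + β j * v j) ∧ x = v ⬝ᵥ ustar} := by
    refine ⟨h ⬝ᵥ q₁ / |c ⬝ᵥ ustar|, ?_⟩
    rintro _ ⟨v, hv, hqv, rfl⟩
    rw [le_div_iff₀' hlam, hcost v hv, neg_le_iff_add_nonneg, dotProduct, dotProduct,
      ← Finset.sum_add_distrib]
    refine Finset.sum_nonneg fun j _ => ?_
    have := mul_nonneg (hh j).le (hqv j)
    simp only [hc]; linarith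
  suffices hsup : dtilde K β ustar q₂ ≤
      dtilde K β ustar q₁ + (h ⬝ᵥ (q₂ - q₁) + B * t) / |c ⬝ᵥ ustar| by
    have := mul_le_mul_of_nonneg_left (sub_le_iff_le_add'.mpr hsup) hlam.le
    rwa [mul_div_cancel₀ _ hlam.ne'] at this
  refine csSup_le ⟨0, 0, by simp, by simpa using hq₂, by simp⟩ ?_
  rintro _ ⟨v, hv, hqv, rfl⟩
  obtain ⟨w, hw0, hKw, hcw⟩ := hrep ((fun j => q₂ j / β j) + v) (kmVec K β q₁) t
    (fun j => by
      have := div_nonneg (hqv j) (hβ j).le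
      rwa [add_div, mul_div_cancel_left₀ _ (hβ j).ne'] at this)
    (mulVec_nonneg_of_nonneg hK0 fun j => div_nonneg (hq₁ j) (hβ j).le)
    (Real.sqrt_nonneg _)
    (fun i => by
      rw [Matrix.mulVec_add, hv, add_zero, abs_sub_comm]
      exact abs_le_euclNorm (fun i => kmVec K β q₂ i - kmVec K β q₁ i) i)
  have hKv : K *ᵥ (w - fun j => q₁ j / β j) = 0 := by
    rw [Matrix.mulVec_sub, hKw]; exact sub_self _
  have hle := le_csSup hbdd ⟨w - fun j => q₁ j / β j, hKv, fun j => by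
    rw [Pi.sub_apply, mul_sub, mul_div_cancel₀ _ (hβ j).ne', add_sub_cancel]
    exact mul_nonneg (hβ j).le (hw0 j), rfl⟩
  refine le_trans ?_ (add_le_add_left hle _)
  rw [← sub_le_iff_le_add', le_div_iff₀' hlam, mul_sub, hcost v hv, hcost _ hKv,
    dotProduct_sub, dotProduct_sub, hscale]
  rw [dotProduct_add, hscale] at hcw
  linarith
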